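/- Let D be the 8-dimensional ℂ-vector space with basis {u_a : a ∈ K} ∪ {v_{ij} : i,j ∈ {1,2}}, equipped with the ℂ-bilinear multiplication determined by: u_a·u_b = u_{a+b}; u_a·v_{ij} = Σ_{k,l} (P_a)_{ik}(P_a)_{lj} v_{kl}; v_{ij}·u_a = Σ_{k,l} (Q_a)_{ik}(Q_a)_{lj} v_{kl}, where Q_{(0,0)} = I₂, Q_{(0,1)} = X, Q_{(1,0)} = Z, Q_{(1,1)} = Y; and v_{ij}·v_{kl} = (1/4)(X+Z)_{ik}(X+Z)_{jl}·u_{(0,0)} + (1/4)(I₂+iY)_{ik}(I₂+iY)_{jl}·u_{(0,1)} + (1/4)(I₂−iY)_{ik}(I₂−iY)_{jl}·u_{(1,0)} + (1/4)(X−Z)_{ik}(X−Z)_{jl}·u_{(1,1)}. Then this multiplication is associative with two-sided unit u_{(0,0)}, D is isomorphic as a ℂ-algebra to ℂ⁴ × M₂(ℂ), and D has exactly four unital ℂ-algebra homomorphisms to ℂ. (D is the self-interface algebra of the unique Rep(H₈) SPT phase, H₈ being the Kac–Paljutkin Hopf algebra.) -/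

import Mathlib

noncomputable section

namespace RepH8Interface

/-- `K = ℤ/2 × ℤ/2`. -/
abbrev K : Type := ZMod 2 × ZMod 2

/-- Basis of the interface algebra: `u_a` for `a ∈ K` and `v_{ij}` for `i,j ∈ {1,2}`. -/
abbrev Bas : Type := K ⊕ (Fin 2 × Fin 2)

/-- The underlying 8-dimensional ℂ-vector space. -/
abbrev D' : Type := Bas →₀ ℂ

/-- Basis vector `u_a`. -/
def u (a : K) : D' := Finsupp.single (Sum.inl a) 1

/-- Basis vector `v_{ij}`. -/
def v (i j : Fin 2) : D' := Finsupp.single (Sum.inr (i, j)) 1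

/-- Pauli matrix `X`. -/
def X : Matrix (Fin 2) (Fin 2) ℂ := !![0, 1; 1, 0]

/-- Pauli matrix `Y`. -/
def Y : Matrix (Fin 2) (Fin 2) ℂ := !![0, -Complex.I; Complex.I, 0]

/-- Pauli matrix `Z`. -/
def Z : Matrix (Fin 2) (Fin 2) ℂ := !![1, 0; 0, -1]

/-- `P_{(0,0)} = I₂`, `P_{(0,1)} = Z`, `P_{(1,0)} = X`, `P_{(1,1)} = Y`. -/
def P : K → Matrix (Fin 2) (Fin 2) ℂ := fun a =>
  if a = (0, 0) then 1 else if a = (0, 1) then Z else if a = (1, 0) then X else Y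

/-- `Q_{(0,0)} = I₂`, `Q_{(0,1)} = X`, `Q_{(1,0)} = Z`, `Q_{(1,1)} = Y`. -/
def Q : K → Matrix (Fin 2) (Fin 2) ℂ := fun a =>
  if a = (0, 0) then 1 else if a = (0, 1) then X else if a = (1, 0) then Z else Y

/-- Structure constants of the algebra `D` (the self-interface algebra of the unique
`Rep(H₈)` SPT phase, `H₈` the Kac–Paljutkin Hopf algebra):
`u_a·u_b = u_{a+b}`;
`u_a·v_{ij} = Σ_{k,l} (P_a)_{ik}(P_a)_{lj} v_{kl}`;
`v_{ij}·u_a = Σ_{k,l} (Q_a)_{ik}(Q_a)_{lj} v_{kl}`;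
`v_{ij}·v_{kl} = ¼(X+Z)_{ik}(X+Z)_{jl}·u_{(0,0)} + ¼(I₂+iY)_{ik}(I₂+iY)_{jl}·u_{(0,1)}
  + ¼(I₂−iY)_{ik}(I₂−iY)_{jl}·u_{(1,0)} + ¼(X−Z)_{ik}(X−Z)_{jl}·u_{(1,1)}`. -/
def mulB : Bas → Bas → D'
  | Sum.inl a, Sum.inl b => u (a + b)
  | Sum.inl a, Sum.inr (i, j) => ∑ k : Fin 2, ∑ l : Fin 2, (P a i k * P a l j) • v k l
  | Sum.inr (i, j), Sum.inl a => ∑ k : Fin 2, ∑ l : Fin 2, (Q a i k * Q a l j) • v k l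
  | Sum.inr (i, j), Sum.inr (k, l) =>
      ((1 : ℂ) / 4 * ((X + Z) i k * (X + Z) j l)) • u (0, 0)
        + ((1 : ℂ) / 4 * ((1 + Complex.I • Y) i k * (1 + Complex.I • Y) j l)) • u (0, 1)
        + ((1 : ℂ) / 4 * ((1 - Complex.I • Y) i k * (1 - Complex.I • Y) j l)) • u (1, 0)
        + ((1 : ℂ) / 4 * ((X - Z) i k * (X - Z) j l)) • u (1, 1)

/-- The ℂ-bilinear multiplication of `D` determined by the structure constants. -/
def mulA (x y : D') : D' :=
  x.sum fun b c => y.sum fun b' c' => (c * c') • mulB b b'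

/-- The target algebra `ℂ⁴ × M₂(ℂ)`. -/
abbrev Target : Type := (Fin 4 → ℂ) × Matrix (Fin 2) (Fin 2) ℂ

/-- The images of the basis vectors of `D` under the isomorphism with `ℂ⁴ × M₂(ℂ)`. -/
def toTargetBasis : Bas → Target
  | Sum.inl a =>
      if a = (0, 0) then (![1, 1, 1, 1], !![1, 0; 0, 1])
      else if a = (0, 1) then (![1, 1, -1, -1], !![-1, 0; 0, 1])
      else if a = (1, 0) then (![1, 1, -1, -1], !![1, 0; 0, -1])
      else (![1, 1, 1, 1], !![-1, 0; 0, -1])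
  | Sum.inr (0, 0) => (![1, -1, 0, 0], !![0, 0; 1, 0])
  | Sum.inr (0, 1) => (![0, 0, Complex.I, -Complex.I], !![0, 1; 0, 0])
  | Sum.inr (1, 0) => (![0, 0, -Complex.I, Complex.I], !![0, 1; 0, 0])
  | Sum.inr (1, 1) => (![1, -1, 0, 0], !![0, 0; -1, 0])

/-- The linear extension of `toTargetBasis`. -/
def toTarget : D' →ₗ[ℂ] Target := Finsupp.linearCombination ℂ toTargetBasis

lemma toTarget_u (a : K) : toTarget (u a) = toTargetBasis (Sum.inl a) := by
  simp [toTarget, u]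

lemma toTarget_v (i j : Fin 2) : toTarget (v i j) = toTargetBasis (Sum.inr (i, j)) := by
  simp [toTarget, v]

lemma K_cases (a : K) : a = (0, 0) ∨ a = (0, 1) ∨ a = (1, 0) ∨ a = (1, 1) := by
  revert a
  decide

lemma target_ext {x y : Target} (h₀ : x.1 0 = y.1 0) (h₁ : x.1 1 = y.1 1) (h₂ : x.1 2 = y.1 2)
    (h₃ : x.1 3 = y.1 3) (h : x.2 = y.2) : x = y := by
  refine Prod.ext (funext fun i => ?_) h
  fin_cases i <;> assumption

lemma toTargetBasis_inl_mul (a b : K) :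
    toTargetBasis (Sum.inl a) * toTargetBasis (Sum.inl b) = toTargetBasis (Sum.inl (a + b)) := by
  have h : (1 : ZMod 2) + 1 = 0 := rfl
  rcases K_cases a with rfl | rfl | rfl | rfl <;> rcases K_cases b with rfl | rfl | rfl | rfl <;>
    apply target_ext <;> simp [toTargetBasis, h]

set_option maxHeartbeats 1000000 in
lemma toTarget_mulB (b b' : Bas) :
    toTarget (mulB b b') = toTargetBasis b * toTargetBasis b' := by
  rcases b with a | ⟨i, j⟩ <;> rcases b' with a' | ⟨k, l⟩
  · rw [toTargetBasis_inl_mul, mulB, toTarget_u]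
  · simp only [mulB, Fin.sum_univ_two]
    rcases K_cases a with rfl | rfl | rfl | rfl <;> fin_cases k <;> fin_cases l <;>
      apply target_ext <;> simp [toTarget_v, toTargetBasis, P, X, Y, Z, Matrix.one_fin_two]
  · simp only [mulB, Fin.sum_univ_two]
    rcases K_cases a' with rfl | rfl | rfl | rfl <;> fin_cases i <;> fin_cases j <;>
      apply target_ext <;> simp [toTarget_v, toTargetBasis, Q, X, Y, Z, Matrix.one_fin_two]
  · have h₀ : X + Z = !![1, 1; 1, -1] := by simp [X, Z]
    have h₁ : 1 + Complex.I • Y = !![1, 1; -1, 1] := by simp [Y, Matrix.one_fin_two]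
    have h₂ : 1 - Complex.I • Y = !![1, -1; 1, 1] := by simp [Y, Matrix.one_fin_two]
    have h₃ : X - Z = !![-1, 1; 1, 1] := by simp [X, Z]
    simp only [mulB, map_add, map_smul, toTarget_u, h₀, h₁, h₂, h₃]
    fin_cases i <;> fin_cases j <;> fin_cases k <;> fin_cases l <;>
      apply target_ext <;> simp [toTargetBasis] <;> norm_num

lemma toTarget_mulA (x y : D') : toTarget (mulA x y) = toTarget x * toTarget y := by
  simp only [mulA, map_finsuppSum, map_smul, toTarget_mulB]
  simp only [toTarget, Finsupp.linearCombination_apply, Finsupp.sum, Finset.sum_mul_sum,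
    smul_mul_smul_comm]

lemma toTarget_one : toTarget (u (0, 0)) = 1 := by
  rw [toTarget_u]
  ext i j
  · fin_cases i <;> simp [toTargetBasis]
  · simp [toTargetBasis, Matrix.one_fin_two]

lemma toTarget_surjective : Function.Surjective toTarget := by
  rintro ⟨c, M⟩
  refine ⟨((c 0 + c 1 + c 2 + c 3) / 8 + (M 0 0 + M 1 1) / 4) • u (0, 0)
    + ((c 0 + c 1 - c 2 - c 3) / 8 + (M 1 1 - M 0 0) / 4) • u (0, 1)
    + ((c 0 + c 1 - c 2 - c 3) / 8 + (M 0 0 - M 1 1) / 4) • u (1, 0)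
    + ((c 0 + c 1 + c 2 + c 3) / 8 - (M 0 0 + M 1 1) / 4) • u (1, 1)
    + ((c 0 - c 1) / 4 + M 1 0 / 2) • v 0 0
    + (M 0 1 / 2 - Complex.I * ((c 2 - c 3) / 4)) • v 0 1
    + (M 0 1 / 2 + Complex.I * ((c 2 - c 3) / 4)) • v 1 0
    + ((c 0 - c 1) / 4 - M 1 0 / 2) • v 1 1, ?_⟩
  simp only [map_add, map_smul, toTarget_u, toTarget_v]
  ext i j
  · fin_cases i <;> simp [toTargetBasis] <;> grind [Complex.I_mul_I]
  · fin_cases i <;> fin_cases j <;> simp [toTargetBasis] <;> ring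

/-- The algebra isomorphism of `D` with `ℂ⁴ × M₂(ℂ)`, as a linear equivalence. -/
def equivTarget : D' ≃ₗ[ℂ] Target :=
  LinearEquiv.ofBijective toTarget
    ⟨(LinearMap.injective_iff_surjective_of_finrank_eq_finrank (by simp [Module.finrank_matrix])).2
      toTarget_surjective, toTarget_surjective⟩

lemma equivTarget_mulA (x y : D') :
    equivTarget (mulA x y) = equivTarget x * equivTarget y :=
  toTarget_mulA x y

lemma equivTarget_one : equivTarget (u (0, 0)) = 1 := toTarget_one

/-- A multiplicative linear functional kills the matrix factor of `ℂⁿ × M₂(ℂ)`. -/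
lemma map_matrix_eq_zero {n : ℕ} (ψ : (Fin n → ℂ) × Matrix (Fin 2) (Fin 2) ℂ →ₗ[ℂ] ℂ)
    (hψ : ∀ x y, ψ (x * y) = ψ x * ψ y) (M : Matrix (Fin 2) (Fin 2) ℂ) : ψ (0, M) = 0 := by
  have sq (x : (Fin n → ℂ) × Matrix (Fin 2) (Fin 2) ℂ) (hx : x * x = 0) : ψ x = 0 := by
    simpa [hx] using (hψ x x).symm
  have h₁ : ψ (0, !![0, 1; 0, 0]) = 0 := sq _ (by simp [← Matrix.ext_iff, Fin.forall_fin_two])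
  have h₂ : ψ (0, 1) = 0 := by
    have h : ((0, 1) : (Fin n → ℂ) × Matrix (Fin 2) (Fin 2) ℂ)
        = (0, !![0, 1; 0, 0]) * (0, !![0, 0; 1, 0])
          + (0, !![0, 0; 1, 0]) * (0, !![0, 1; 0, 0]) := by
      simp [Matrix.one_fin_two]
    rw [h, map_add, hψ, hψ, h₁]
    simp
  simpa [h₂] using hψ (0, M) (0, 1)

/-- The unital multiplicative linear functionals on `ℂⁿ × M₂(ℂ)` are the coordinates of `ℂⁿ`. -/
lemma exists_eq_coordinate {n : ℕ} (ψ : (Fin n → ℂ) × Matrix (Fin 2) (Fin 2) ℂ →ₗ[ℂ] ℂ)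
    (hψ : ∀ x y, ψ (x * y) = ψ x * ψ y) (h_one : ψ 1 = 1) : ∃ i, ∀ x, ψ x = x.1 i := by
  have key (c : Fin n → ℂ) : ψ (c, 0) = ∑ i, c i * ψ (Pi.single i 1, 0) := by
    have h := LinearMap.pi_apply_eq_sum_univ (ψ ∘ₗ LinearMap.inl ℂ _ _) c
    have h' (i : Fin n) : (fun j => if i = j then (1 : ℂ) else 0) = Pi.single i 1 := by
      ext j
      simp [Pi.single_apply, eq_comm]
    simpa [h'] using h
  have split (x : (Fin n → ℂ) × Matrix (Fin 2) (Fin 2) ℂ) : ψ x = ψ (x.1, 0) := by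
    have h : x = (x.1, 0) + (0, x.2) := by simp
    conv_lhs => rw [h, map_add, map_matrix_eq_zero ψ hψ, add_zero]
  obtain ⟨i, hi⟩ : ∃ i, ψ (Pi.single i 1, 0) ≠ 0 := by
    by_contra! h
    rw [split, key] at h_one
    simp [h] at h_one
  refine ⟨i, fun x => mul_right_cancel₀ hi ?_⟩
  have h : x * (Pi.single i 1, 0) = x.1 i • (Pi.single i 1, 0) := by
    ext j
    · by_cases hj : j = i
      · subst hj; simp
      · simp [hj]
    · simp
  rw [← hψ, h, map_smul, smul_eq_mul]

/-- The character of `D` given by the `i`-th coordinate of `ℂ⁴`. -/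
def character (i : Fin 4) : D' →ₗ[ℂ] ℂ :=
  LinearMap.proj i ∘ₗ LinearMap.fst ℂ _ _ ∘ₗ equivTarget.toLinearMap

lemma character_apply (i : Fin 4) (x : D') : character i x = (equivTarget x).1 i := rfl

lemma card_characters :
    Nat.card {φ : D' →ₗ[ℂ] ℂ //
        (∀ x y : D', φ (mulA x y) = φ x * φ y) ∧ φ (u (0, 0)) = 1} = 4 := by
  rw [← Nat.card_fin 4]
  refine (Nat.card_eq_of_bijective (fun i => ⟨character i, fun x y => by
    simp [character_apply, equivTarget_mulA], by simp [character_apply, equivTarget_one]⟩)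
    ⟨?_, ?_⟩).symm
  · intro i j hij
    have h := LinearMap.congr_fun (Subtype.ext_iff.1 hij)
      (equivTarget.symm (Pi.single i 1, 0))
    by_contra hne
    simp [character_apply, Ne.symm hne] at h
  · rintro ⟨φ, h_mul, h_one⟩
    obtain ⟨i, hi⟩ := exists_eq_coordinate (φ ∘ₗ equivTarget.symm.toLinearMap)
      (fun x y => by
        have h : equivTarget.symm (x * y) = mulA (equivTarget.symm x) (equivTarget.symm y) := by
          simp [LinearEquiv.symm_apply_eq, equivTarget_mulA]
        simp [h, h_mul])
      (by
        have h : equivTarget.symm 1 = u (0, 0) := by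
          simp [LinearEquiv.symm_apply_eq, equivTarget_one]
        simp [h, h_one])
    refine ⟨i, Subtype.ext (LinearMap.ext fun x => ?_)⟩
    simpa [character_apply] using (hi (equivTarget x)).symm

/-- The multiplication of `D` is associative with two-sided unit
`u_{(0,0)}`, `D` is isomorphic as a ℂ-algebra to `ℂ⁴ × M₂(ℂ)`, and `D` has exactly
four unital ℂ-algebra homomorphisms to `ℂ`. -/
theorem h8_self_interface_algebra :
    (∀ x y z : D', mulA (mulA x y) z = mulA x (mulA y z)) ∧
    (∀ x : D', mulA (u (0, 0)) x = x ∧ mulA x (u (0, 0)) = x) ∧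
    (∃ f : D' ≃ₗ[ℂ] ((Fin 4 → ℂ) × Matrix (Fin 2) (Fin 2) ℂ),
        (∀ x y : D', f (mulA x y) = f x * f y) ∧ f (u (0, 0)) = 1) ∧
    Nat.card {φ : D' →ₗ[ℂ] ℂ //
        (∀ x y : D', φ (mulA x y) = φ x * φ y) ∧ φ (u (0, 0)) = 1} = 4 := by
  refine ⟨fun x y z => equivTarget.injective ?_, fun x => ⟨equivTarget.injective ?_,
    equivTarget.injective ?_⟩, ⟨equivTarget, equivTarget_mulA, equivTarget_one⟩, card_characters⟩
  · simp only [equivTarget_mulA, mul_assoc]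
  · rw [equivTarget_mulA, equivTarget_one, one_mul]
  · rw [equivTarget_mulA, equivTarget_one, mul_one]

end RepH8Interface
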